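/- Let X be an infinite set. Suppose k ≥ 1, η is a cardinal with ℵ₀ ≤ η ≤ #X, ζ₁, ζ₂ and η₁, …, η_k are cardinals in [η, (#X)⁺], and ξ₁, …, ξ_k are cardinals each equal to 1 or lying in [ℵ₀, η], such that ξ_k < ⋯ < ξ₁ ≤ η < η₁ < ⋯ < η_k = (#X)⁺. Then the relation (λ_{ζ₁}^η ∩ ρ_{ζ₂}^η) ∪ μ_{ξ₁}^{η₁} ∪ ⋯ ∪ μ_{ξ_k}^{η_k} is a congruence on the partition monoid P_X. (Proposition 4.13.) -/

import Mathlib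

open Cardinal
open scoped symmDiff

namespace PartitionCongruences

variable {X : Type*}

/-- A partition over `X` is a setoid on `X ⊕ X`; `PMon X` is the carrier of the
partition monoid. -/
abbrev PMon (X : Type*) := Setoid (X ⊕ X)

/-- The set of blocks of a partition. -/
def cl (α : PMon X) : Set (Set (X ⊕ X)) := α.classes

/-- A block of `α` is a transversal if it meets both summands. -/
def IsTransversal (α : PMon X) (B : Set (X ⊕ X)) : Prop :=
  B ∈ α.classes ∧ (∃ x : X, Sum.inl x ∈ B) ∧ (∃ x : X, Sum.inr x ∈ B)

/-- The rank of a partition: the number of its transversals. -/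
def rank (α : PMon X) : Cardinal :=
  #{B : Set (X ⊕ X) // IsTransversal α B}

/-- The kernel partition `ᾱ`. -/
def ker (α : PMon X) : Set (Set X) := (Setoid.comap Sum.inl α).classes

/-- The cokernel partition `α̲`. -/
def coker (α : PMon X) : Set (Set X) := (Setoid.comap Sum.inr α).classes

/-- Left summand to top copy, right summand to middle copy. -/
def dmap (X : Type*) : X ⊕ X → X ⊕ (X ⊕ X) :=
  Sum.elim Sum.inl (fun x => Sum.inr (Sum.inl x))

/-- Left summand to middle copy, right summand to bottom copy. -/
def umap (X : Type*) : X ⊕ X → X ⊕ (X ⊕ X) :=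
  Sum.elim (fun x => Sum.inr (Sum.inl x)) (fun x => Sum.inr (Sum.inr x))

/-- Left summand to top copy, right summand to bottom copy. -/
def emap (X : Type*) : X ⊕ X → X ⊕ (X ⊕ X) :=
  Sum.elim Sum.inl (fun x => Sum.inr (Sum.inr x))

/-- The pushforward of a setoid along a map: the smallest setoid relating `f x` and
`f y` whenever `σ` relates `x` and `y`. -/
def push {A B : Type*} (f : A → B) (σ : Setoid A) : Setoid B :=
  Relation.EqvGen.setoid (fun a b => ∃ x y, σ x y ∧ f x = a ∧ f y = b)

/-- The product of the partition monoid. -/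
instance : Mul (PMon X) :=
  ⟨fun α β => Setoid.comap (emap X) (push (dmap X) α ⊔ push (umap X) β)⟩


/-- Membership in the Rees relation `R_η = Δ ∪ (I_η × I_η)`, where
`I_η = {α : rank α < η}`. -/
def ReesRel (η : Cardinal) (α β : PMon X) : Prop :=
  α = β ∨ (rank α < η ∧ rank β < η)

/-- The relation `λ_ζ^η = λ_ζ ∩ R_η`. -/
def LambdaRel (ζ η : Cardinal) (α β : PMon X) : Prop :=
  #↥(ker α ∆ ker β) < ζ ∧ ReesRel η α β

/-- The relation `ρ_ζ^η = ρ_ζ ∩ R_η`. -/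
def RhoRel (ζ η : Cardinal) (α β : PMon X) : Prop :=
  #↥(coker α ∆ coker β) < ζ ∧ ReesRel η α β

/-- The relation `μ_ξ^η = μ_ξ ∩ R_η`. -/
def MuRel (ξ η : Cardinal) (α β : PMon X) : Prop :=
  #↥(cl α ∆ cl β) < ξ ∧ ReesRel η α β

section Generation

variable {A Y : Type*}

theorem push_rel (f : A → Y) {σ : Setoid A} {a b : A} (h : σ a b) : push f σ (f a) (f b) :=
  Relation.EqvGen.rel _ _ ⟨a, b, h, rfl, rfl⟩

theorem push_le {f : A → Y} {σ : Setoid A} {S : Setoid Y}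
    (h : ∀ a b, σ a b → S (f a) (f b)) : push f σ ≤ S := by
  intro x y hxy
  induction hxy with
  | rel x y h' => obtain ⟨a, b, hab, rfl, rfl⟩ := h'; exact h a b hab
  | refl x => exact S.refl x
  | symm x y _ ih => exact S.symm ih
  | trans x y z _ _ ih₁ ih₂ => exact S.trans ih₁ ih₂

/-- A predicate preserved by `σ` is constant on the classes of `push f σ`. -/
theorem push_le_ker {f : A → Y} {σ : Setoid A} {P : Y → Prop}
    (h : ∀ a b, σ a b → P (f a) → P (f b)) : push f σ ≤ Setoid.ker P :=
  push_le fun a b hab => propext ⟨h a b hab, h b a (σ.symm hab)⟩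

theorem le_ker {σ : Setoid Y} {P : Y → Prop}
    (h : ∀ a b, σ a b → P a → P b) : σ ≤ Setoid.ker P :=
  fun {a b} hab => propext ⟨h a b hab, h b a (σ.symm hab)⟩

theorem of_rel_of_le_ker {S : Setoid Y} {P : Y → Prop} (hS : S ≤ Setoid.ker P) {y z : Y}
    (h : S y z) (hy : P y) : P z :=
  (show P y = P z from hS h) ▸ hy

/-- Replacing one generator of a join creates no more new classes than the generator
itself has. -/
theorem mk_classes_diff_le {A Y W : Type u} (f : A → Y) (e : W → Y) (α β : Setoid A)
    (τ : Setoid Y) :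
    #↥((Setoid.comap e (push f α ⊔ τ)).classes \ (Setoid.comap e (push f β ⊔ τ)).classes) ≤
      #↥(α.classes \ β.classes) := by
  have key : ∀ C : ↥((Setoid.comap e (push f α ⊔ τ)).classes \
      (Setoid.comap e (push f β ⊔ τ)).classes), ∃ a : A, {b | α b a} ∉ β.classes ∧
        (C : Set W) = {w | (push f α ⊔ τ) (e w) (f a)} := by
    rintro ⟨C, ⟨w, rfl⟩, hC⟩
    by_contra! hcon
    have hblock : ∀ a, (push f α ⊔ τ) (e w) (f a) → ∀ b, α a b ↔ β a b := by
      intro a ha b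
      have h1 : {b | α b a} ∈ β.classes := by
        by_contra h
        refine hcon a h ?_
        ext v
        exact ⟨fun hv => Setoid.trans' _ hv ha,
          fun hv => Setoid.trans' _ hv (Setoid.symm' _ ha)⟩
      obtain ⟨c, hc⟩ := h1
      have hac : β a c := by
        have : a ∈ {b | α b a} := α.refl a
        rwa [hc] at this
      have hb : α b a ↔ β b c := Set.ext_iff.mp hc b
      rw [α.comm', hb]
      exact ⟨fun h => β.trans hac (β.symm h), fun h => β.trans (β.symm h) hac⟩
    refine hC ⟨w, ?_⟩
    ext v
    constructor
    · intro hv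
      have hle : push f α ⊔ τ ≤ Setoid.ker
          (fun y => (push f α ⊔ τ) (e w) y ∧ (push f β ⊔ τ) (e w) y) := by
        refine sup_le (push_le_ker ?_) (le_ker ?_)
        · rintro a b hab ⟨h1, h2⟩
          exact ⟨Setoid.trans' _ h1 (le_sup_left (a := push f α) (push_rel f hab)),
            Setoid.trans' _ h2 (le_sup_left (a := push f β)
              (push_rel f ((hblock a h1 b).mp hab)))⟩
        · rintro a b hab ⟨h1, h2⟩
          exact ⟨Setoid.trans' _ h1 (le_sup_right (b := τ) hab),
            Setoid.trans' _ h2 (le_sup_right (b := τ) hab)⟩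
      exact Setoid.symm' _ (of_rel_of_le_ker hle (Setoid.symm' _ hv)
        ⟨Setoid.refl' _ _, Setoid.refl' _ _⟩).2
    · intro hv
      have hle : push f β ⊔ τ ≤ Setoid.ker (fun y => (push f α ⊔ τ) (e w) y) := by
        refine sup_le (push_le_ker ?_) (le_ker ?_)
        · intro a b hab h1
          exact Setoid.trans' _ h1 (le_sup_left (a := push f α)
            (push_rel f ((hblock a h1 b).mpr hab)))
        · intro a b hab h1
          exact Setoid.trans' _ h1 (le_sup_right (b := τ) hab)
      exact Setoid.symm' _ (of_rel_of_le_ker hle (Setoid.symm' _ hv) (Setoid.refl' _ _))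
  choose a ha hCa using key
  refine Cardinal.mk_le_of_injective
    (f := fun C => (⟨{b | α b (a C)}, ⟨a C, rfl⟩, ha C⟩ : ↥(α.classes \ β.classes))) ?_
  intro C D hCD
  have h : α (a C) (a D) := by
    have h1 : {b | α b (a C)} = {b | α b (a D)} := congrArg Subtype.val hCD
    have h2 : a C ∈ {b | α b (a C)} := α.refl _
    rwa [h1] at h2
  have h3 : (push f α ⊔ τ) (f (a C)) (f (a D)) := le_sup_left (a := push f α) (push_rel f h)
  apply Subtype.ext
  rw [hCa C, hCa D]
  ext v
  exact ⟨fun hv => Setoid.trans' _ hv h3, fun hv => Setoid.trans' _ hv (Setoid.symm' _ h3)⟩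

theorem mk_symmDiff_eq {A : Type u} (s t : Set A) :
    #↥(s ∆ t) = #↥(s \ t) + #↥(t \ s) := by
  rw [Set.symmDiff_def]
  exact Cardinal.mk_union_of_disjoint disjoint_sdiff_sdiff

theorem mk_symmDiff_triangle {A : Type u} (s t r : Set A) :
    #↥(s ∆ r) ≤ #↥(s ∆ t) + #↥(t ∆ r) :=
  (Cardinal.mk_le_mk_of_subset (symmDiff_triangle s t r)).trans (Cardinal.mk_union_le _ _)

end Generation

section Product

/-- The involution of the partition monoid. -/
abbrev involution (α : PMon X) : PMon X := Setoid.comap Sum.swap α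

theorem involution_rel {α : PMon X} {a b : X ⊕ X} : involution α a b ↔ α a.swap b.swap := Iff.rfl

theorem involution_involution (α : PMon X) : involution (involution α) = α := by
  ext a b
  simp [involution_rel]

theorem involution_mul_le (α β : PMon X) : involution (α * β) ≤ involution β * involution α := by
  let r : X ⊕ (X ⊕ X) → X ⊕ (X ⊕ X) :=
    Sum.elim (fun x => .inr (.inr x)) (Sum.elim (fun x => .inr (.inl x)) .inl)
  have key : push (dmap X) α ⊔ push (umap X) β ≤
      Setoid.comap r (push (dmap X) (involution β) ⊔ push (umap X) (involution α)) := by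
    refine sup_le (push_le ?_) (push_le ?_)
    · intro a b hab
      have h : ∀ c : X ⊕ X, r (dmap X c) = umap X c.swap := by rintro (c | c) <;> rfl
      rw [Setoid.comap_rel, h, h]
      refine le_sup_right (b := push (umap X) (involution α)) (push_rel _ ?_)
      simpa [involution_rel] using hab
    · intro a b hab
      have h : ∀ c : X ⊕ X, r (umap X c) = dmap X c.swap := by rintro (c | c) <;> rfl
      rw [Setoid.comap_rel, h, h]
      refine le_sup_left (a := push (dmap X) (involution β)) (push_rel _ ?_)
      simpa [involution_rel] using hab
  intro a b hab
  have h : ∀ c : X ⊕ X, r (emap X c.swap) = emap X c := by rintro (c | c) <;> rfl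
  have := key (show (push (dmap X) α ⊔ push (umap X) β) (emap X a.swap) (emap X b.swap) from hab)
  rwa [Setoid.comap_rel, h, h] at this

theorem involution_mul (α β : PMon X) : involution (α * β) = involution β * involution α := by
  refine le_antisymm (involution_mul_le α β) ?_
  have h := involution_mul_le (involution β) (involution α)
  rw [involution_involution, involution_involution] at h
  intro a b hab
  refine h (show (involution β * involution α) a.swap.swap b.swap.swap from ?_)
  simpa using hab

theorem mem_cl_involution {α : PMon X} {B : Set (X ⊕ X)} :
    B ∈ cl (involution α) ↔ Sum.swap ⁻¹' B ∈ cl α := by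
  constructor
  · rintro ⟨y, rfl⟩
    refine ⟨y.swap, ?_⟩
    ext v
    simp [involution_rel]
  · rintro ⟨y, hy⟩
    refine ⟨y.swap, ?_⟩
    ext v
    have := Set.ext_iff.mp hy v.swap
    simpa [involution_rel] using this

theorem swap_preimage_injective :
    Function.Injective (fun B : Set (X ⊕ X) => Sum.swap ⁻¹' B) :=
  Sum.swap_rightInverse.surjective.preimage_injective

theorem mk_cl_involution_symmDiff_le (α β : PMon X) :
    #↥(cl (involution α) ∆ cl (involution β)) ≤ #↥(cl α ∆ cl β) := by
  refine Cardinal.mk_le_of_injective (f := fun B =>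
    (⟨Sum.swap ⁻¹' B.1, ?_⟩ : ↥(cl α ∆ cl β))) ?_
  · have := B.2
    simpa only [Set.mem_symmDiff, mem_cl_involution] using this
  · intro B C h
    exact Subtype.ext (swap_preimage_injective (congrArg Subtype.val h))

theorem rank_involution_le (α : PMon X) : rank (involution α) ≤ rank α := by
  refine Cardinal.mk_le_of_injective (f := fun B =>
    (⟨Sum.swap ⁻¹' B.1, mem_cl_involution.mp B.2.1, B.2.2.2, B.2.2.1⟩ :
      {B // IsTransversal α B})) ?_
  intro B C h
  exact Subtype.ext (swap_preimage_injective (congrArg Subtype.val h))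

theorem rank_involution (α : PMon X) : rank (involution α) = rank α :=
  le_antisymm (rank_involution_le α) (by simpa only [involution_involution] using rank_involution_le (involution α))

/-- An upper nontransversal block is a connected component of every product graph. -/
theorem mul_rel_inl_of_forall_not {α γ : PMon X} {x : X}
    (hx : ∀ m, ¬ α (Sum.inl x) (Sum.inr m)) {z : X ⊕ X} (h : (α * γ) (Sum.inl x) z) :
    ∃ x', z = Sum.inl x' ∧ α (Sum.inl x) (Sum.inl x') := by
  have hle : push (dmap X) α ⊔ push (umap X) γ ≤
      Setoid.ker (fun y => ∃ x', y = Sum.inl x' ∧ α (Sum.inl x) (Sum.inl x')) := by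
    refine sup_le (push_le_ker ?_) (push_le_ker ?_)
    · rintro (a | a) (b | b) hab ⟨x', h1, h2⟩
      · cases h1
        exact ⟨b, rfl, α.trans h2 hab⟩
      · cases h1
        exact absurd (α.trans h2 hab) (hx b)
      · cases h1
      · cases h1
    · rintro (a | a) b hab ⟨x', h1, h2⟩ <;> cases h1
  obtain ⟨x', h1, h2⟩ := of_rel_of_le_ker hle (z := emap X z) h ⟨x, rfl, α.refl _⟩
  rcases z with w | w
  · cases h1
    exact ⟨_, rfl, h2⟩
  · cases h1

theorem mul_rel_inl_inl {α γ : PMon X} {x y : X} (h : α (Sum.inl x) (Sum.inl y)) :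
    (α * γ) (Sum.inl x) (Sum.inl y) :=
  le_sup_left (a := push (dmap X) α) (push_rel (dmap X) h)

theorem isTransversal_block {α : PMon X} {x m : X} (h : α (Sum.inl x) (Sum.inr m)) :
    IsTransversal α {z | α z (Sum.inl x)} :=
  ⟨⟨_, rfl⟩, ⟨x, α.refl _⟩, ⟨m, α.symm h⟩⟩

/-- A family of objects determined by the block of an upper point on a transversal has
size at most the rank. -/
theorem mk_le_rank {T X : Type u} {α : PMon X} {p : T → X → Prop}
    (h : ∀ t : T, ∃ x m, α (Sum.inl x) (Sum.inr m) ∧ p t x)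
    (hp : ∀ t s x y, p t x → p s y → α (Sum.inl x) (Sum.inl y) → t = s) : #T ≤ rank α := by
  choose x m hxm hpx using h
  refine Cardinal.mk_le_of_injective (f := fun t =>
    (⟨_, isTransversal_block (hxm t)⟩ : {B // IsTransversal α B})) ?_
  intro t s hts
  have h1 : {z | α z (Sum.inl (x t))} = {z | α z (Sum.inl (x s))} := congrArg Subtype.val hts
  have h2 : Sum.inl (x t) ∈ {z | α z (Sum.inl (x t))} := α.refl _
  rw [h1] at h2
  exact hp t s _ _ (hpx t) (hpx s) h2

theorem class_eq_of_rel {A : Type*} (σ : Setoid A) {a b : A} (h : σ a b) :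
    {c | σ c a} = {c | σ c b} :=
  Set.ext fun _ => ⟨fun hc => σ.trans hc h, fun hc => σ.trans hc (σ.symm h)⟩

theorem rank_mul_le_left (α γ : PMon X) : rank (α * γ) ≤ rank α := by
  refine mk_le_rank (p := fun B x => B.1 = {z | (α * γ) z (Sum.inl x)}) ?_ ?_
  · rintro ⟨B, ⟨y, rfl⟩, ⟨x, hx⟩, ⟨x', hx'⟩⟩
    have hxx' : (α * γ) (Sum.inl x) (Sum.inr x') := Setoid.trans' _ hx (Setoid.symm' _ hx')
    have hm : ∃ m, α (Sum.inl x) (Sum.inr m) := by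
      by_contra! hm
      obtain ⟨_, h, -⟩ := mul_rel_inl_of_forall_not hm hxx'
      cases h
    obtain ⟨m, hm⟩ := hm
    exact ⟨x, m, hm, class_eq_of_rel _ (Setoid.symm' _ hx)⟩
  · rintro B C x y hB hC hxy
    apply Subtype.ext
    rw [hB, hC]
    exact class_eq_of_rel _ (mul_rel_inl_inl hxy)

theorem ker_mul_class_eq {α γ : PMon X} {x : X} (hx : ∀ m, ¬ α (Sum.inl x) (Sum.inr m)) :
    {y | Setoid.comap Sum.inl (α * γ) y x} = {y | Setoid.comap Sum.inl α y x} := by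
  ext y
  constructor
  · intro h
    obtain ⟨x', h1, h2⟩ := mul_rel_inl_of_forall_not hx (Setoid.symm' _ h)
    cases h1
    exact α.symm h2
  · exact fun h => mul_rel_inl_inl h

theorem mk_ker_symmDiff_ker_mul_le (α γ : PMon X) :
    #↥(ker α ∆ ker (α * γ)) ≤ rank α + rank α := by
  rw [mk_symmDiff_eq]
  refine add_le_add ?_ ?_
  · refine mk_le_rank (p := fun K x => K.1 = {y | Setoid.comap Sum.inl α y x}) ?_ ?_
    · rintro ⟨K, ⟨x, rfl⟩, hK⟩
      by_contra! hcon
      exact hK ⟨x, (ker_mul_class_eq fun m hm => hcon x m hm rfl).symm⟩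
    · rintro K L x y hK hL hxy
      apply Subtype.ext
      rw [hK, hL]
      exact class_eq_of_rel (Setoid.comap Sum.inl α) hxy
  · refine mk_le_rank (p := fun K x => K.1 = {y | Setoid.comap Sum.inl (α * γ) y x}) ?_ ?_
    · rintro ⟨K, ⟨x, rfl⟩, hK⟩
      by_contra! hcon
      exact hK ⟨x, ker_mul_class_eq fun m hm => hcon x m hm rfl⟩
    · rintro K L x y hK hL hxy
      apply Subtype.ext
      rw [hK, hL]
      exact class_eq_of_rel (Setoid.comap Sum.inl (α * γ)) (mul_rel_inl_inl hxy)

theorem mk_cl_mul_symmDiff_le (α β γ : PMon X) :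
    #↥(cl (α * γ) ∆ cl (β * γ)) ≤ #↥(cl α ∆ cl β) := by
  rw [mk_symmDiff_eq, mk_symmDiff_eq]
  exact add_le_add (mk_classes_diff_le _ _ α β _) (mk_classes_diff_le _ _ β α _)

/-- The cokernel of a product depends on its first factor only through the cokernel. -/
theorem comap_inr_mul (α γ : PMon X) :
    Setoid.comap Sum.inr (α * γ) =
      Setoid.comap Sum.inr (push Sum.inl (Setoid.comap Sum.inr α) ⊔ γ) := by
  apply le_antisymm
  · intro a b hab
    set S : PMon X := push Sum.inl (Setoid.comap Sum.inr α) ⊔ γ with hS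
    let Q : X ⊕ (X ⊕ X) → Prop :=
      Sum.elim (fun x => ∃ m, α (Sum.inl x) (Sum.inr m) ∧ S (Sum.inr a) (Sum.inl m))
        (fun w => S (Sum.inr a) w)
    have hmid : ∀ m n, α (Sum.inr m) (Sum.inr n) → S (Sum.inl m) (Sum.inl n) := fun m n h =>
      le_sup_left (a := push Sum.inl (Setoid.comap Sum.inr α))
        (push_rel Sum.inl (σ := Setoid.comap Sum.inr α) h)
    have hle : push (dmap X) α ⊔ push (umap X) γ ≤ Setoid.ker Q := by
      refine sup_le (push_le_ker ?_) (push_le_ker ?_)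
      · rintro (x | x) (y | y) hxy hx
        · obtain ⟨m, h1, h2⟩ := hx
          exact ⟨m, α.trans (α.symm hxy) h1, h2⟩
        · obtain ⟨m, h1, h2⟩ := hx
          exact S.trans h2 (hmid _ _ (α.trans (α.symm h1) hxy))
        · exact ⟨x, α.symm hxy, hx⟩
        · exact S.trans (show S (Sum.inr a) (Sum.inl x) from hx) (hmid _ _ hxy)
      · intro x y hxy hx
        have hu : ∀ w, Q (umap X w) = S (Sum.inr a) w := by rintro (w | w) <;> rfl
        rw [hu] at hx ⊢
        exact S.trans hx (le_sup_right (b := γ) hxy)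
    exact of_rel_of_le_ker (P := Q) (y := emap X (Sum.inr a)) (z := emap X (Sum.inr b)) hle hab
      (S.refl _)
  · have hle : push Sum.inl (Setoid.comap Sum.inr α) ⊔ γ ≤
        Setoid.comap (umap X) (push (dmap X) α ⊔ push (umap X) γ) := by
      refine sup_le (push_le ?_) ?_
      · intro x y hxy
        exact le_sup_left (a := push (dmap X) α)
          (push_rel (dmap X) (a := Sum.inr x) (b := Sum.inr y) hxy)
      · intro x y hxy
        exact le_sup_right (b := push (umap X) γ) (push_rel (umap X) hxy)
    intro a b hab
    exact hle hab

theorem mk_coker_mul_symmDiff_le (α β γ : PMon X) :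
    #↥(coker (α * γ) ∆ coker (β * γ)) ≤ #↥(coker α ∆ coker β) := by
  rw [mk_symmDiff_eq, mk_symmDiff_eq]
  simp only [coker, comap_inr_mul]
  exact add_le_add (mk_classes_diff_le _ _ _ _ _) (mk_classes_diff_le _ _ _ _ _)

theorem mk_ker_diff_le (α β : PMon X) : #↥(ker α \ ker β) ≤ #↥(cl α \ cl β) := by
  have key : ∀ K : ↥(ker α \ ker β), ∃ B : ↥(cl α \ cl β), Sum.inl ⁻¹' B.1 = K.1 := by
    rintro ⟨K, ⟨x, rfl⟩, hK⟩
    refine ⟨⟨{z | α z (Sum.inl x)}, ⟨_, rfl⟩, ?_⟩, rfl⟩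
    rintro ⟨y, hy⟩
    have hx : Sum.inl x ∈ {z | α z (Sum.inl x)} := α.refl _
    rw [hy] at hx
    refine hK ⟨x, ?_⟩
    ext z
    have hz : α (Sum.inl z) (Sum.inl x) ↔ β (Sum.inl z) y := Set.ext_iff.mp hy (Sum.inl z)
    exact hz.trans ⟨fun h => β.trans h (β.symm hx), fun h => β.trans h hx⟩
  choose B hB using key
  refine Cardinal.mk_le_of_injective (f := B) fun K L h => Subtype.ext ?_
  rw [← hB K, ← hB L, h]

theorem mk_ker_symmDiff_le (α β : PMon X) : #↥(ker α ∆ ker β) ≤ #↥(cl α ∆ cl β) := by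
  rw [mk_symmDiff_eq, mk_symmDiff_eq]
  exact add_le_add (mk_ker_diff_le α β) (mk_ker_diff_le β α)

theorem mk_coker_symmDiff_le (α β : PMon X) : #↥(coker α ∆ coker β) ≤ #↥(cl α ∆ cl β) :=
  (mk_ker_symmDiff_le (involution α) (involution β)).trans (mk_cl_involution_symmDiff_le α β)

theorem rank_le_add (α β : PMon X) : rank β ≤ rank α + #↥(cl α ∆ cl β) := by
  refine le_trans (Cardinal.mk_le_mk_of_subset (t := {B | IsTransversal α B} ∪ cl α ∆ cl β) ?_)
    (Cardinal.mk_union_le _ _)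
  intro B hB
  by_cases h : B ∈ cl α
  · exact Or.inl ⟨h, hB.2⟩
  · exact Or.inr (Or.inr ⟨hB.1, h⟩)

end Product

section Relations

variable {η ξ ζ ζ₁ ζ₂ : Cardinal} {α β γ : PMon X}

theorem ReesRel.symm (h : ReesRel η α β) : ReesRel η β α :=
  h.imp Eq.symm And.symm

theorem ReesRel.trans (h : ReesRel η α β) (h' : ReesRel η β γ) : ReesRel η α γ := by
  rcases h with rfl | h
  · exact h'
  · rcases h' with rfl | h'
    · exact Or.inr h
    · exact Or.inr ⟨h.1, h'.2⟩

theorem ReesRel.mul_right (h : ReesRel η α β) (γ : PMon X) : ReesRel η (α * γ) (β * γ) :=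
  h.imp (congrArg (· * γ)) fun h =>
    ⟨(rank_mul_le_left α γ).trans_lt h.1, (rank_mul_le_left β γ).trans_lt h.2⟩

theorem ReesRel.dual (h : ReesRel η α β) :
    ReesRel η (involution α) (involution β) := by
  unfold ReesRel
  rw [rank_involution, rank_involution]
  exact h.imp_left (congrArg involution)

theorem LambdaRel.refl (hζ : 0 < ζ) (α : PMon X) : LambdaRel ζ η α α :=
  ⟨by simpa using hζ, Or.inl rfl⟩

theorem RhoRel.refl (hζ : 0 < ζ) (α : PMon X) : RhoRel ζ η α α :=
  ⟨by simpa using hζ, Or.inl rfl⟩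

theorem LambdaRel.symm (h : LambdaRel ζ η α β) : LambdaRel ζ η β α :=
  ⟨symmDiff_comm (ker α) (ker β) ▸ h.1, h.2.symm⟩

theorem RhoRel.symm (h : RhoRel ζ η α β) : RhoRel ζ η β α :=
  ⟨symmDiff_comm (coker α) (coker β) ▸ h.1, h.2.symm⟩

theorem MuRel.symm (h : MuRel ξ η α β) : MuRel ξ η β α :=
  ⟨symmDiff_comm (cl α) (cl β) ▸ h.1, h.2.symm⟩

theorem LambdaRel.trans (hζ : ℵ₀ ≤ ζ) (h : LambdaRel ζ η α β) (h' : LambdaRel ζ η β γ) :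
    LambdaRel ζ η α γ :=
  ⟨(mk_symmDiff_triangle _ _ _).trans_lt (Cardinal.add_lt_of_lt hζ h.1 h'.1), h.2.trans h'.2⟩

theorem RhoRel.trans (hζ : ℵ₀ ≤ ζ) (h : RhoRel ζ η α β) (h' : RhoRel ζ η β γ) :
    RhoRel ζ η α γ :=
  ⟨(mk_symmDiff_triangle _ _ _).trans_lt (Cardinal.add_lt_of_lt hζ h.1 h'.1), h.2.trans h'.2⟩

theorem LambdaRel.mul_right (hη : ℵ₀ ≤ η) (hηζ : η ≤ ζ) (h : LambdaRel ζ η α β) (γ : PMon X) :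
    LambdaRel ζ η (α * γ) (β * γ) := by
  have hζ := hη.trans hηζ
  rcases h with ⟨h, rfl | hr⟩
  · exact LambdaRel.refl (Cardinal.aleph0_pos.trans_le hζ) _
  have hker : ∀ δ : PMon X, rank δ < η → #↥(ker δ ∆ ker (δ * γ)) < ζ := fun δ hδ =>
    (mk_ker_symmDiff_ker_mul_le δ γ).trans_lt ((Cardinal.add_lt_of_lt hη hδ hδ).trans_le hηζ)
  refine ⟨?_, ReesRel.mul_right (Or.inr hr) γ⟩
  refine (mk_symmDiff_triangle _ (ker α) _).trans_lt (Cardinal.add_lt_of_lt hζ ?_ ?_)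
  · rw [symmDiff_comm]
    exact hker α hr.1
  · exact (mk_symmDiff_triangle _ (ker β) _).trans_lt
      (Cardinal.add_lt_of_lt hζ h (hker β hr.2))

theorem RhoRel.mul_right (h : RhoRel ζ η α β) (γ : PMon X) : RhoRel ζ η (α * γ) (β * γ) :=
  ⟨(mk_coker_mul_symmDiff_le α β γ).trans_lt h.1, h.2.mul_right γ⟩

theorem MuRel.mul_right (h : MuRel ξ η α β) (γ : PMon X) : MuRel ξ η (α * γ) (β * γ) :=
  ⟨(mk_cl_mul_symmDiff_le α β γ).trans_lt h.1, h.2.mul_right γ⟩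

theorem LambdaRel.dual (h : LambdaRel ζ η α β) :
    RhoRel ζ η (involution α) (involution β) :=
  ⟨h.1, h.2.dual⟩

theorem RhoRel.dual (h : RhoRel ζ η α β) :
    LambdaRel ζ η (involution α) (involution β) :=
  ⟨h.1, h.2.dual⟩

theorem MuRel.dual (h : MuRel ξ η α β) :
    MuRel ξ η (involution α) (involution β) :=
  ⟨(mk_cl_involution_symmDiff_le α β).trans_lt h.1, h.2.dual⟩

theorem LambdaRel.mul_left (h : LambdaRel ζ η α β) (γ : PMon X) :
    LambdaRel ζ η (γ * α) (γ * β) := by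
  have := (h.dual.mul_right (involution γ)).dual
  simpa only [involution_mul, involution_involution] using this

theorem RhoRel.mul_left (hη : ℵ₀ ≤ η) (hηζ : η ≤ ζ) (h : RhoRel ζ η α β) (γ : PMon X) :
    RhoRel ζ η (γ * α) (γ * β) := by
  have := (h.dual.mul_right hη hηζ (involution γ)).dual
  simpa only [involution_mul, involution_involution] using this

theorem MuRel.mul_left (h : MuRel ξ η α β) (γ : PMon X) : MuRel ξ η (γ * α) (γ * β) := by
  have := (h.dual.mul_right (involution γ)).dual
  simpa only [involution_mul, involution_involution] using this

/-- A set of blocks of size less than `η` does not affect whether the rank is below `η`. -/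
theorem MuRel.rank_lt {θ : Cardinal} (hη : ℵ₀ ≤ η) (hξ : ξ ≤ η) (h : MuRel ξ θ α β)
    (hα : rank α < η) : rank β < η :=
  (rank_le_add α β).trans_lt (Cardinal.add_lt_of_lt hη hα (h.1.trans_le hξ))

theorem MuRel.lambda_rho {θ : Cardinal} (hη : ℵ₀ ≤ η) (hξ : ξ ≤ η) (hζ₁ : η ≤ ζ₁)
    (hζ₂ : η ≤ ζ₂) (h : MuRel ξ θ α β) (hα : rank α < η) :
    LambdaRel ζ₁ η α β ∧ RhoRel ζ₂ η α β :=
  have hR : ReesRel η α β := Or.inr ⟨hα, h.rank_lt hη hξ hα⟩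
  ⟨⟨(mk_ker_symmDiff_le α β).trans_lt (h.1.trans_le (hξ.trans hζ₁)), hR⟩,
    ⟨(mk_coker_symmDiff_le α β).trans_lt (h.1.trans_le (hξ.trans hζ₂)), hR⟩⟩

theorem MuRel.eq_of_one (h : MuRel 1 η α β) : α = β := by
  have h0 : cl α ∆ cl β = ∅ := by
    have := Cardinal.lt_one_iff.mp h.1
    rwa [Cardinal.mk_set_eq_zero_iff] at this
  exact Setoid.classes_inj.mpr (symmDiff_eq_bot.mp h0)

/-- Along a descending pair of parameters, composing stays inside one of the two relations. -/
theorem MuRel.trans_of_le {ξ' θ θ' : Cardinal} (hη : ℵ₀ ≤ η) (hξ : ξ = 1 ∨ ℵ₀ ≤ ξ)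
    (hξ' : ξ' ≤ ξ) (hξη : ξ' ≤ η) (hθ : η ≤ θ) (h : MuRel ξ θ α β) (h' : MuRel ξ' θ' β γ) :
    MuRel ξ θ α γ ∨ MuRel ξ' θ' α γ := by
  rcases h.2 with rfl | hr
  · exact Or.inr h'
  rcases hξ with rfl | hξ
  · exact Or.inr (h.eq_of_one ▸ h')
  exact Or.inl ⟨(mk_symmDiff_triangle _ (cl β) _).trans_lt
    (Cardinal.add_lt_of_lt hξ h.1 (h'.1.trans_le hξ')),
    Or.inr ⟨hr.1, h'.rank_lt (hη.trans hθ) (hξη.trans hθ) hr.2⟩⟩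

end Relations

/-- Proposition 4.13: with parameters as in type (CT2) of the classification
theorem, the relation `(λ_{ζ₁}^η ∩ ρ_{ζ₂}^η) ∪ μ_{ξ₁}^{η₁} ∪ ⋯ ∪ μ_{ξ_k}^{η_k}`
is a congruence on the partition monoid `P_X`. -/
theorem CT2_isCongruence [Infinite X] (k : ℕ) (hk : 1 ≤ k)
    (η ζ₁ ζ₂ : Cardinal) (ξ ηs : Fin k → Cardinal)
    (hη : ℵ₀ ≤ η ∧ η ≤ #X)
    (hζ₁ : η ≤ ζ₁ ∧ ζ₁ ≤ Order.succ #X)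
    (hζ₂ : η ≤ ζ₂ ∧ ζ₂ ≤ Order.succ #X)
    (hηs : ∀ i, η ≤ ηs i ∧ ηs i ≤ Order.succ #X)
    (hξ : ∀ i, ξ i = 1 ∨ (ℵ₀ ≤ ξ i ∧ ξ i ≤ η))
    (hξanti : StrictAnti ξ) (hξ₁ : ξ ⟨0, by omega⟩ ≤ η)
    (hηsmono : StrictMono ηs) (hη₁ : η < ηs ⟨0, by omega⟩)
    (hηk : ηs ⟨k - 1, by omega⟩ = Order.succ #X) :
    ∃ c : Con (PMon X), ∀ α β : PMon X,
      c α β ↔ ((LambdaRel ζ₁ η α β ∧ RhoRel ζ₂ η α β) ∨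
        ∃ i : Fin k, MuRel (ξ i) (ηs i) α β) := by
  have hη₀ := hη.1
  have hξη : ∀ i, ξ i ≤ η := fun i =>
    (hξ i).elim (fun h => h ▸ Cardinal.one_lt_aleph0.le.trans hη₀) And.right
  have hξ' : ∀ i, ξ i = 1 ∨ ℵ₀ ≤ ξ i := fun i => (hξ i).imp_right And.left
  have hz₁ := hη₀.trans hζ₁.1
  have hz₂ := hη₀.trans hζ₂.1
  let r : PMon X → PMon X → Prop := fun α β =>
    (LambdaRel ζ₁ η α β ∧ RhoRel ζ₂ η α β) ∨ ∃ i : Fin k, MuRel (ξ i) (ηs i) α β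
  have hsymm : ∀ {α β}, r α β → r β α := fun h =>
    h.imp (fun h => ⟨h.1.symm, h.2.symm⟩) fun ⟨i, h⟩ => ⟨i, h.symm⟩
  have hmixed : ∀ {α β γ}, LambdaRel ζ₁ η α β ∧ RhoRel ζ₂ η α β →
      (∃ i : Fin k, MuRel (ξ i) (ηs i) β γ) → r α γ := by
    rintro α β γ h ⟨i, hi⟩
    rcases h.1.2 with rfl | hr
    · exact Or.inr ⟨i, hi⟩
    · have h' := hi.lambda_rho hη₀ (hξη i) hζ₁.1 hζ₂.1 hr.2
      exact Or.inl ⟨h.1.trans hz₁ h'.1, h.2.trans hz₂ h'.2⟩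
  have hmu : ∀ {α β γ} {i j : Fin k}, i ≤ j → MuRel (ξ i) (ηs i) α β →
      MuRel (ξ j) (ηs j) β γ → r α γ := fun {α β γ i j} hij h h' =>
    Or.inr ((h.trans_of_le hη₀ (hξ' i) (hξanti.antitone hij) (hξη j) (hηs i).1 h').elim
      (fun h => ⟨i, h⟩) fun h => ⟨j, h⟩)
  have htrans : ∀ {α β γ}, r α β → r β γ → r α γ := by
    intro α β γ h h'
    rcases h with h | ⟨i, hi⟩ <;> rcases h' with h' | ⟨j, hj⟩
    · exact Or.inl ⟨h.1.trans hz₁ h'.1, h.2.trans hz₂ h'.2⟩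
    · exact hmixed h ⟨j, hj⟩
    · exact hsymm (hmixed ⟨h'.1.symm, h'.2.symm⟩ ⟨i, hi.symm⟩)
    · rcases le_total i j with hij | hij
      · exact hmu hij hi hj
      · exact hsymm (hmu hij hj.symm hi.symm)
  have hright : ∀ {α β} γ, r α β → r (α * γ) (β * γ) := fun γ h =>
    h.imp (fun h => ⟨h.1.mul_right hη₀ hζ₁.1 γ, h.2.mul_right γ⟩)
      fun ⟨i, h⟩ => ⟨i, h.mul_right γ⟩
  have hleft : ∀ {α β} γ, r α β → r (γ * α) (γ * β) := fun γ h =>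
    h.imp (fun h => ⟨h.1.mul_left γ, h.2.mul_left hη₀ hζ₂.1 γ⟩)
      fun ⟨i, h⟩ => ⟨i, h.mul_left γ⟩
  exact ⟨{ r := r
           iseqv := ⟨fun α => Or.inl ⟨.refl (Cardinal.aleph0_pos.trans_le hz₁) α,
             .refl (Cardinal.aleph0_pos.trans_le hz₂) α⟩, hsymm, htrans⟩
           mul' := fun {w x y _} h h' => htrans (hright y h) (hleft x h') },
    fun _ _ => Iff.rfl⟩

end PartitionCongruences
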